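/- arXiv:1708.06332 — 4 statements merged into one kernel-verified Lean document; each statement's English description precedes it below -/
import Mathlib

section
/- There is a constant c > 0, depending only on the dimension d, such that for every continuous function h : B → ℝ one has ∫_{∂₊} ( ∫_0^{τ(x,v)} |h(x+tv)| (1 − ‖x+tv‖²)^{-1/2} dt )² dμ(x,v) ≤ c² (sup_{y∈B} |h(y)|)². In other words, the X-ray transform satisfies ‖I(d_M^{-1/2} h)‖_{L²_μ(∂₊)} ≤ c ‖h‖_∞ for all h ∈ C(B), where d_M(y) = (1 − ‖y‖²)/2. (This is the Euclidean unit-ball, unattenuated case of Theorem 2.2(b) of the paper.) -/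
open MeasureTheory Metric Set
open scoped RealInnerProductSpace ENNReal

noncomputable section

/-- The surface measure on the unit sphere `S^{d-1}` of `ℝ^d`. -/
def sphereMeasure (d : ℕ) : Measure (Metric.sphere (0 : EuclideanSpace ℝ (Fin d)) 1) :=
  (volume : Measure (EuclideanSpace ℝ (Fin d))).toSphere

/-- Exit time `τ(x,v) = -⟨x,v⟩ + √(1 - ‖x‖² + ⟨x,v⟩²)` of the line `t ↦ x + t v`
from the closed unit ball. -/
def exitTime {d : ℕ} (x v : EuclideanSpace ℝ (Fin d)) : ℝ :=
  -⟪x, v⟫ + Real.sqrt (1 - ‖x‖ ^ 2 + ⟪x, v⟫ ^ 2)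

/-- The arcsine density integrates to `π`; as an upper bound this needs no case split at `s = 0`. -/
theorem lintegral_inv_sqrt_mul_sub_le {s : ℝ} (hs : 0 ≤ s) :
    ∫⁻ t in Ioo (0 : ℝ) (2 * s), ENNReal.ofReal (Real.sqrt (t * (2 * s - t)))⁻¹
      ≤ ENNReal.ofReal Real.pi := by
  rcases hs.eq_or_lt with rfl | hs
  · simp
  have hcont : ContinuousOn (fun t : ℝ => Real.arcsin ((t - s) / s)) (Icc 0 (2 * s)) :=
    (Real.continuous_arcsin.comp (by fun_prop)).continuousOn
  have hderiv : ∀ t ∈ Ioo (0 : ℝ) (2 * s), HasDerivAt (fun t : ℝ => Real.arcsin ((t - s) / s))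
      (Real.sqrt (t * (2 * s - t)))⁻¹ t := by
    rintro t ⟨h0, h1⟩
    have hne1 : (t - s) / s ≠ -1 := by
      intro h
      rw [div_eq_iff hs.ne'] at h
      linarith
    have hne2 : (t - s) / s ≠ 1 := by
      intro h
      rw [div_eq_iff hs.ne'] at h
      linarith
    refine ((Real.hasDerivAt_arcsin hne1 hne2).comp t
      (((hasDerivAt_id t).sub_const s).div_const s)).congr_deriv ?_
    have hsq : t * (2 * s - t) = s ^ 2 * (1 - ((t - s) / s) ^ 2) := by
      field_simp
      ring
    rw [hsq, Real.sqrt_mul (sq_nonneg s), Real.sqrt_sq hs.le, mul_inv]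
    ring
  have hint : IntegrableOn (fun t : ℝ => (Real.sqrt (t * (2 * s - t)))⁻¹) (Ioc 0 (2 * s)) :=
    intervalIntegral.integrableOn_deriv_of_nonneg hcont hderiv fun t _ => by positivity
  have hval := intervalIntegral.integral_eq_sub_of_hasDerivAt_of_le (by linarith) hcont hderiv
    ((intervalIntegrable_iff_integrableOn_Ioc_of_le (by linarith)).2 hint)
  rw [Measure.restrict_congr_set Ioo_ae_eq_Ioc,
    ← ofReal_integral_eq_lintegral_ofReal hint (ae_of_all _ fun t => by positivity),
    ← intervalIntegral.integral_of_le (by linarith), hval]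
  apply ENNReal.ofReal_le_ofReal
  linarith [Real.arcsin_le_pi_div_two ((2 * s - s) / s), Real.neg_pi_div_two_le_arcsin ((0 - s) / s)]

theorem one_sub_norm_add_smul_sq {d : ℕ} {x v : EuclideanSpace ℝ (Fin d)} (hx : ‖x‖ = 1)
    (hv : ‖v‖ = 1) (t : ℝ) : 1 - ‖x + t • v‖ ^ 2 = t * (2 * (-⟪x, v⟫) - t) := by
  rw [norm_add_sq_real, hx, norm_smul, hv, inner_smul_right, mul_one, Real.norm_eq_abs, sq_abs]
  ring

theorem exitTime_of_inner_nonpos {d : ℕ} {x v : EuclideanSpace ℝ (Fin d)} (hx : ‖x‖ = 1)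
    (hxv : ⟪x, v⟫ ≤ 0) : exitTime x v = 2 * (-⟪x, v⟫) := by
  rw [exitTime, hx, show (1 : ℝ) - 1 ^ 2 + ⟪x, v⟫ ^ 2 = (-⟪x, v⟫) ^ 2 by ring,
    Real.sqrt_sq (by linarith)]
  ring

/-- A pointwise bound for the X-ray transform of `|h| (1 - ‖·‖²)^{-1/2}` along a chord. -/
theorem lintegral_chord_le {d : ℕ} {x v : EuclideanSpace ℝ (Fin d)} (hx : ‖x‖ = 1)
    (hv : ‖v‖ = 1) (hxv : ⟪x, v⟫ ≤ 0) {h : EuclideanSpace ℝ (Fin d) → ℝ} {M : ℝ}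
    (hM : ∀ y ∈ closedBall (0 : EuclideanSpace ℝ (Fin d)) 1, |h y| ≤ M) :
    ∫⁻ t in Ioo (0 : ℝ) (exitTime x v),
        ENNReal.ofReal (|h (x + t • v)| * (Real.sqrt (1 - ‖x + t • v‖ ^ 2))⁻¹)
      ≤ ENNReal.ofReal (M * Real.pi) := by
  have hM0 : 0 ≤ M := (abs_nonneg _).trans (hM 0 (by simp))
  rw [exitTime_of_inner_nonpos hx hxv]
  calc
    _ ≤ ∫⁻ t in Ioo (0 : ℝ) (2 * (-⟪x, v⟫)),
        ENNReal.ofReal M * ENNReal.ofReal (Real.sqrt (t * (2 * (-⟪x, v⟫) - t)))⁻¹ := by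
      refine setLIntegral_mono' measurableSet_Ioo fun t ht => ?_
      have hsub := one_sub_norm_add_smul_sq hx hv t
      have hpos : 0 < t * (2 * (-⟪x, v⟫) - t) := mul_pos ht.1 (sub_pos.2 ht.2)
      have hball : x + t • v ∈ closedBall (0 : EuclideanSpace ℝ (Fin d)) 1 := by
        rw [mem_closedBall_zero_iff]
        nlinarith [norm_nonneg (x + t • v)]
      rw [hsub, ← ENNReal.ofReal_mul hM0]
      gcongr
      exact hM _ hball
    _ = ENNReal.ofReal M * ∫⁻ t in Ioo (0 : ℝ) (2 * (-⟪x, v⟫)),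
        ENNReal.ofReal (Real.sqrt (t * (2 * (-⟪x, v⟫) - t)))⁻¹ :=
      lintegral_const_mul _ (by fun_prop)
    _ ≤ ENNReal.ofReal (M * Real.pi) := by
      rw [ENNReal.ofReal_mul hM0]
      gcongr
      exact lintegral_inv_sqrt_mul_sub_le (by linarith)

/-- Theorem 2.2(b) of the paper (Euclidean unit ball, unattenuated case): there is
`c > 0` depending only on `d` such that
`‖I(d_M^{-1/2} h)‖_{L²_μ(∂₊)} ≤ c ‖h‖_∞` for every continuous `h` on the closed ball. -/
theorem xray_of_boundary_singular_bounded (d : ℕ) (hd : 2 ≤ d) :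
    ∃ c : ℝ, 0 < c ∧
      ∀ h : EuclideanSpace ℝ (Fin d) → ℝ,
        ContinuousOn h (Metric.closedBall 0 1) →
        (∫⁻ x : Metric.sphere (0 : EuclideanSpace ℝ (Fin d)) 1,
            ∫⁻ v : Metric.sphere (0 : EuclideanSpace ℝ (Fin d)) 1,
              (if ⟪(x : EuclideanSpace ℝ (Fin d)), (v : EuclideanSpace ℝ (Fin d))⟫ ≤ 0 then
                ENNReal.ofReal
                    |⟪(x : EuclideanSpace ℝ (Fin d)), (v : EuclideanSpace ℝ (Fin d))⟫| *
                  (∫⁻ t in Ioo (0 : ℝ)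
                      (exitTime (x : EuclideanSpace ℝ (Fin d)) (v : EuclideanSpace ℝ (Fin d))),
                    ENNReal.ofReal
                      (|h ((x : EuclideanSpace ℝ (Fin d)) + t • (v : EuclideanSpace ℝ (Fin d)))| *
                        (Real.sqrt (1 -
                          ‖(x : EuclideanSpace ℝ (Fin d)) + t • (v : EuclideanSpace ℝ (Fin d))‖ ^ 2))⁻¹)) ^ 2
              else 0) ∂(sphereMeasure d) ∂(sphereMeasure d))
          ≤ ENNReal.ofReal
              (c ^ 2 * (sSup ((fun y => |h y|) '' Metric.closedBall (0 : EuclideanSpace ℝ (Fin d)) 1)) ^ 2) := by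
  have : IsFiniteMeasure (sphereMeasure d) := by
    unfold sphereMeasure
    infer_instance
  set ω : ℝ := (sphereMeasure d).real univ with hω_def
  have hω : 0 ≤ ω := measureReal_nonneg
  refine ⟨Real.pi * ω + 1, by positivity, fun h hh => ?_⟩
  set M := sSup ((fun y => |h y|) '' closedBall (0 : EuclideanSpace ℝ (Fin d)) 1)
  have hM : ∀ y ∈ closedBall (0 : EuclideanSpace ℝ (Fin d)) 1, |h y| ≤ M := fun y hy =>
    le_csSup ((isCompact_closedBall _ _).bddAbove_image hh.abs) (mem_image_of_mem _ hy)
  have hM0 : 0 ≤ M := (abs_nonneg _).trans (hM 0 (by simp))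
  calc
    _ ≤ ∫⁻ _ : sphere (0 : EuclideanSpace ℝ (Fin d)) 1,
          ∫⁻ _ : sphere (0 : EuclideanSpace ℝ (Fin d)) 1,
            ENNReal.ofReal (M * Real.pi) ^ 2 ∂(sphereMeasure d) ∂(sphereMeasure d) := by
      refine lintegral_mono fun x => lintegral_mono fun v => ?_
      have hx : ‖(x : EuclideanSpace ℝ (Fin d))‖ = 1 := norm_eq_of_mem_sphere x
      have hv : ‖(v : EuclideanSpace ℝ (Fin d))‖ = 1 := norm_eq_of_mem_sphere v
      dsimp only
      split_ifs with hxv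
      · have hle : ENNReal.ofReal
            |⟪(x : EuclideanSpace ℝ (Fin d)), (v : EuclideanSpace ℝ (Fin d))⟫| ≤ 1 := by
          rw [ENNReal.ofReal_le_one]
          simpa [hx, hv] using
            abs_real_inner_le_norm (x : EuclideanSpace ℝ (Fin d)) (v : EuclideanSpace ℝ (Fin d))
        rw [← one_mul (ENNReal.ofReal (M * Real.pi) ^ 2)]
        gcongr
        exact lintegral_chord_le hx hv hxv hM
      · exact zero_le
    _ = ENNReal.ofReal ((M * Real.pi) ^ 2 * ω * ω) := by
      rw [lintegral_const, lintegral_const, ENNReal.ofReal_mul (q := ω) (by positivity),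
        ENNReal.ofReal_mul (q := ω) (by positivity), ENNReal.ofReal_pow (by positivity), hω_def,
        ofReal_measureReal]
    _ ≤ _ := by
      apply ENNReal.ofReal_le_ofReal
      have hπω : 0 ≤ Real.pi * ω := by positivity
      nlinarith [sq_nonneg M, mul_nonneg (sq_nonneg M) hπω]
end
end

section
/- There is a constant C > 0, depending only on the dimension d, such that for every measurable function f : B → [0,∞], ∫_{∂₊} ( ∫_0^{τ(x,v)} f(x+tv) dt )² dμ(x,v) ≤ C ∫_B f(y)² (1 − ‖y‖²)^{1/2} dy. That is, the X-ray transform I is bounded from the weighted space L²(B, (1−‖y‖²)^{1/2} dy) to L²_μ(∂₊). (This is the Euclidean unit-ball case of Lemma 5.6(i) of the paper.) -/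
open MeasureTheory Metric Set
open scoped RealInnerProductSpace ENNReal

noncomputable section

section ChordEstimate

theorem hasDerivAt_chord_primitive {T t : ℝ} (ht : t ∈ Ioo 0 T) :
    HasDerivAt (fun s : ℝ => 2 * √s - 2 * √(T - s)) ((√t)⁻¹ + (√(T - t))⁻¹) t := by
  have h₁ := (Real.hasDerivAt_sqrt ht.1.ne').const_mul 2
  have h₂ := (((hasDerivAt_id t).const_sub T).sqrt (sub_pos.2 ht.2).ne').const_mul 2
  refine (h₁.sub h₂).congr_deriv ?_
  simp only [id]
  ring

theorem inv_sqrt_chord_le {T t : ℝ} (ht : t ∈ Ioo 0 T) :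
    (√(t * (T - t)))⁻¹ ≤ (√T)⁻¹ * ((√t)⁻¹ + (√(T - t))⁻¹) := by
  have h₁ : 0 < √t := Real.sqrt_pos.2 ht.1
  have h₂ : 0 < √(T - t) := Real.sqrt_pos.2 (sub_pos.2 ht.2)
  have h₃ : 0 < √T := Real.sqrt_pos.2 (ht.1.trans ht.2)
  have h : √T ≤ √t + √(T - t) := by
    rw [Real.sqrt_le_left (by positivity), add_sq, Real.sq_sqrt ht.1.le,
      Real.sq_sqrt (sub_pos.2 ht.2).le]
    nlinarith [mul_pos h₁ h₂]
  rw [Real.sqrt_mul ht.1.le]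
  calc (√t * √(T - t))⁻¹ = (√T)⁻¹ * (√T * (√t * √(T - t))⁻¹) := by field_simp
    _ ≤ (√T)⁻¹ * ((√t + √(T - t)) * (√t * √(T - t))⁻¹) := by gcongr
    _ = (√T)⁻¹ * ((√t)⁻¹ + (√(T - t))⁻¹) := by field_simp; ring

theorem lintegral_inv_sqrt_chord_le {T : ℝ} (hT : 0 < T) :
    ∫⁻ t in Ioo 0 T, ENNReal.ofReal (√(t * (T - t)))⁻¹ ≤ ENNReal.ofReal 4 := by
  have hcont : ContinuousOn (fun s : ℝ => 2 * √s - 2 * √(T - s)) (Icc 0 T) := by fun_prop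
  have hpos : ∀ t ∈ Ioo 0 T, 0 ≤ (√t)⁻¹ + (√(T - t))⁻¹ := fun t _ => by positivity
  have hint := intervalIntegral.integrableOn_deriv_of_nonneg hcont
    (fun t ht => hasDerivAt_chord_primitive ht) hpos
  have heq := intervalIntegral.integral_eq_sub_of_hasDerivAt_of_le hT.le hcont
    (fun t ht => hasDerivAt_chord_primitive ht)
    ((intervalIntegrable_iff_integrableOn_Ioc_of_le hT.le).2 hint)
  rw [intervalIntegral.integral_of_le hT.le, integral_Ioc_eq_integral_Ioo] at heq
  calc ∫⁻ t in Ioo 0 T, ENNReal.ofReal (√(t * (T - t)))⁻¹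
      ≤ ∫⁻ t in Ioo 0 T, ENNReal.ofReal ((√T)⁻¹ * ((√t)⁻¹ + (√(T - t))⁻¹)) :=
        setLIntegral_mono' measurableSet_Ioo fun t ht =>
          ENNReal.ofReal_le_ofReal (inv_sqrt_chord_le ht)
    _ = ENNReal.ofReal (∫ t in Ioo 0 T, (√T)⁻¹ * ((√t)⁻¹ + (√(T - t))⁻¹)) :=
        (ofReal_integral_eq_lintegral_ofReal
          ((hint.mono_set Ioo_subset_Ioc_self).const_mul _)
          (Filter.Eventually.of_forall fun t => by positivity)).symm
    _ = ENNReal.ofReal 4 := by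
        have : √T ≠ 0 := (Real.sqrt_pos.2 hT).ne'
        rw [integral_const_mul, heq]
        congr 1
        simp
        field_simp
        norm_num

/-- Cauchy-Schwarz inequality for the lower Lebesgue integral. -/
theorem sq_lintegral_mul_le {α : Type*} [MeasurableSpace α] (μ : Measure α) {f g : α → ℝ≥0∞}
    (hf : AEMeasurable f μ) (hg : AEMeasurable g μ) :
    (∫⁻ a, f a * g a ∂μ) ^ 2 ≤ (∫⁻ a, f a ^ 2 ∂μ) * ∫⁻ a, g a ^ 2 ∂μ := by
  have h := ENNReal.lintegral_mul_le_Lp_mul_Lq μ Real.HolderConjugate.two_two hf hg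
  have hsq (a : ℝ≥0∞) : (a ^ (1 / 2 : ℝ)) ^ 2 = a := by
    rw [← ENNReal.rpow_natCast, ← ENNReal.rpow_mul]
    norm_num
  calc (∫⁻ a, f a * g a ∂μ) ^ 2 ≤ _ := pow_le_pow_left' h 2
    _ = _ := by simp only [mul_pow, hsq, ENNReal.rpow_two]

theorem sq_lintegral_chord_le {T : ℝ} {f : ℝ → ℝ≥0∞} (hf : Measurable f) :
    (∫⁻ t in Ioo 0 T, f t) ^ 2 ≤
      ENNReal.ofReal 4 * ∫⁻ t in Ioo 0 T, f t ^ 2 * ENNReal.ofReal √(t * (T - t)) := by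
  rcases le_or_gt T 0 with hT | hT
  · simp [Ioo_eq_empty_of_le hT]
  set w : ℝ → ℝ≥0∞ := fun t => ENNReal.ofReal √√(t * (T - t)) with hw
  set w' : ℝ → ℝ≥0∞ := fun t => ENNReal.ofReal (√√(t * (T - t)))⁻¹ with hw'
  have hwm : Measurable w := by fun_prop
  have hwm' : Measurable w' := by fun_prop
  have h1 : ∫⁻ t in Ioo 0 T, f t = ∫⁻ t in Ioo 0 T, (f t * w t) * w' t := by
    refine setLIntegral_congr_fun measurableSet_Ioo fun t ht => ?_
    have : 0 < √√(t * (T - t)) :=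
      Real.sqrt_pos.2 (Real.sqrt_pos.2 (mul_pos ht.1 (sub_pos.2 ht.2)))
    simp only [hw, hw', mul_assoc]
    rw [← ENNReal.ofReal_mul this.le, mul_inv_cancel₀ this.ne', ENNReal.ofReal_one, mul_one]
  have h2 (t : ℝ) : (f t * w t) ^ 2 = f t ^ 2 * ENNReal.ofReal √(t * (T - t)) := by
    rw [mul_pow, hw, ← ENNReal.ofReal_pow (Real.sqrt_nonneg _), Real.sq_sqrt (Real.sqrt_nonneg _)]
  have h3 (t : ℝ) : w' t ^ 2 = ENNReal.ofReal (√(t * (T - t)))⁻¹ := by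
    rw [hw', ← ENNReal.ofReal_pow (by positivity), inv_pow, Real.sq_sqrt (Real.sqrt_nonneg _)]
  rw [h1]
  refine (sq_lintegral_mul_le _ (hf.mul hwm).aemeasurable hwm'.aemeasurable).trans ?_
  rw [mul_comm]
  simp only [Pi.mul_apply, h2, h3]
  gcongr
  exact lintegral_inv_sqrt_chord_le hT

end ChordEstimate

section Santalo

variable {E : Type*} [NormedAddCommGroup E] [InnerProductSpace ℝ E]

/-- The map sending `t • x`, with `x` a unit vector and `t > 0`, to the point reached at time `t`
when starting from `x` with velocity `v`. -/
def sphereFlow (v z : E) : E := ‖z‖⁻¹ • z + ‖z‖ • v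

/-- The points `t • x` for which the point reached at time `t` from `x` with velocity `v` lies in
the open unit ball. -/
def sphereFlowDomain (v : E) : Set E := {z | ⟪z, v⟫ < 0 ∧ ‖z‖ ^ 2 < -2 * ⟪z, v⟫}

theorem ne_zero_of_mem_sphereFlowDomain {v z : E} (hz : z ∈ sphereFlowDomain v) : z ≠ 0 := by
  rintro rfl
  simp [sphereFlowDomain] at hz

theorem sphereFlow_smul {v x : E} (hx : ‖x‖ = 1) {t : ℝ} (ht : 0 < t) :
    sphereFlow v (t • x) = x + t • v := by
  simp [sphereFlow, norm_smul, hx, abs_of_pos ht, smul_smul, ht.ne']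

theorem exists_unit_of_mem_sphereFlowDomain {v z : E} (hz : z ∈ sphereFlowDomain v) :
    ∃ x : E, ∃ t : ℝ, ‖x‖ = 1 ∧ 0 < t ∧ ⟪x, v⟫ < 0 ∧ t < -2 * ⟪x, v⟫ ∧ z = t • x := by
  have h0 := ne_zero_of_mem_sphereFlowDomain hz
  have hp : 0 < ‖z‖ := norm_pos_iff.2 h0
  obtain ⟨h1, h2⟩ := hz
  refine ⟨‖z‖⁻¹ • z, ‖z‖, by simp [norm_smul, hp.ne'], hp, ?_, ?_, by simp [smul_smul, hp.ne']⟩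
  · rw [real_inner_smul_left]
    exact mul_neg_of_pos_of_neg (by positivity) h1
  · rw [real_inner_smul_left, mul_left_comm, ← div_eq_inv_mul, lt_div_iff₀ hp]
    nlinarith

theorem norm_add_smul_sq {v x : E} (hv : ‖v‖ = 1) (hx : ‖x‖ = 1) (t : ℝ) :
    ‖x + t • v‖ ^ 2 = 1 + 2 * t * ⟪x, v⟫ + t ^ 2 := by
  rw [norm_add_sq_real, norm_smul, real_inner_smul_right, hv, hx, mul_one, Real.norm_eq_abs, sq_abs]
  ring

theorem injOn_sphereFlow {v : E} (hv : ‖v‖ = 1) : InjOn (sphereFlow v) (sphereFlowDomain v) := by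
  intro z hz z' hz' h
  obtain ⟨x, t, hx, ht, hxv, -, rfl⟩ := exists_unit_of_mem_sphereFlowDomain hz
  obtain ⟨x', t', hx', ht', hxv', -, rfl⟩ := exists_unit_of_mem_sphereFlowDomain hz'
  rw [sphereFlow_smul hx ht, sphereFlow_smul hx' ht'] at h
  have hinner : ⟪x, v⟫ + t = ⟪x', v⟫ + t' := by
    have := congrArg (fun y => ⟪y, v⟫) h
    simpa [inner_add_left, real_inner_smul_left, hv] using this
  have hnorm : 1 + 2 * t * ⟪x, v⟫ + t ^ 2 = 1 + 2 * t' * ⟪x', v⟫ + t' ^ 2 := by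
    rw [← norm_add_smul_sq hv hx, ← norm_add_smul_sq hv hx', h]
  have hsq : (⟪x, v⟫ - ⟪x', v⟫) * (⟪x, v⟫ + ⟪x', v⟫) = 0 := by
    linear_combination (⟪x, v⟫ + t + ⟪x', v⟫ + t') * hinner - hnorm
  have ht_eq : t = t' := by
    rcases mul_eq_zero.1 hsq with h' | h' <;> linarith
  subst ht_eq
  rw [add_right_cancel h]

theorem sphereFlow_mem_closedBall {v z : E} (hv : ‖v‖ = 1) (hz : z ∈ sphereFlowDomain v) :
    sphereFlow v z ∈ closedBall (0 : E) 1 := by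
  obtain ⟨x, t, hx, ht, -, htx, rfl⟩ := exists_unit_of_mem_sphereFlowDomain hz
  rw [sphereFlow_smul hx ht, mem_closedBall_zero_iff, ← sq_le_one_iff₀ (norm_nonneg _),
    norm_add_smul_sq hv hx]
  nlinarith

variable [FiniteDimensional ℝ E]

/-- The derivative of `sphereFlow v` at `z`. -/
def sphereFlowDeriv (v z : E) : E →L[ℝ] E :=
  LinearMap.toContinuousLinearMap (‖z‖⁻¹ • LinearMap.transvection
    (innerSL ℝ z : E →ₗ[ℝ] ℝ) (v - (‖z‖ ^ 2)⁻¹ • z))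

theorem hasFDerivAt_sphereFlow (v : E) {z : E} (hz : z ≠ 0) :
    HasFDerivAt (sphereFlow v) (sphereFlowDeriv v z) z := by
  have hz' : ‖z‖ ≠ 0 := norm_ne_zero_iff.2 hz
  have hn : HasFDerivAt (fun y : E => ‖y‖) (‖z‖⁻¹ • innerSL ℝ z) z := by
    have := (hasStrictFDerivAt_norm_sq z).hasFDerivAt.sqrt (by positivity)
    simp only [Real.sqrt_sq (norm_nonneg _)] at this
    convert this using 1
    ext h
    simp
    field_simp
  have h : HasFDerivAt (sphereFlow v) _ z :=
    (((hasDerivAt_inv hz').comp_hasFDerivAt z hn).smul (hasFDerivAt_id z)).add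
      (hn.smul_const v)
  refine h.congr_fderiv ?_
  ext y
  simp [sphereFlowDeriv, LinearMap.transvection.apply, smul_add, smul_sub, smul_smul]
  module

theorem det_sphereFlowDeriv (v : E) {z : E} (hz : z ≠ 0) :
    (sphereFlowDeriv v z).det = (‖z‖ ^ Module.finrank ℝ E)⁻¹ * ⟪z, v⟫ := by
  have hz' : ‖z‖ ≠ 0 := norm_ne_zero_iff.2 hz
  rw [sphereFlowDeriv, LinearMap.det_toContinuousLinearMap, LinearMap.det_smul,
    LinearMap.transvection.det]
  simp [inner_sub_right, inner_smul_right, hz']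

variable [MeasurableSpace E] [BorelSpace E]

theorem measurableSet_sphereFlowDomain (v : E) : MeasurableSet (sphereFlowDomain v) :=
  (measurableSet_lt (f := fun z => ⟪z, v⟫) (g := fun _ => 0) (by fun_prop) (by fun_prop)).inter
    (measurableSet_lt (f := fun z => ‖z‖ ^ 2) (g := fun z => -2 * ⟪z, v⟫)
      (by fun_prop) (by fun_prop))

theorem measurable_sphereFlow (v : E) : Measurable (sphereFlow v) := by
  unfold sphereFlow
  fun_prop

theorem lintegral_eq_lintegral_toSphere [Nontrivial E] (μ : Measure E) [μ.IsAddHaarMeasure]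
    {h : E → ℝ≥0∞} (hh : Measurable h) :
    ∫⁻ z, h z ∂μ = ∫⁻ x : sphere (0 : E) 1, (∫⁻ t in Ioi (0 : ℝ),
      ENNReal.ofReal (t ^ (Module.finrank ℝ E - 1)) * h (t • (x : E))) ∂μ.toSphere := by
  have hm : Measurable fun p : sphere (0 : E) 1 × Ioi (0 : ℝ) => h ((p.2 : ℝ) • (p.1 : E)) := by
    fun_prop
  calc ∫⁻ z, h z ∂μ = ∫⁻ z : ({(0)}ᶜ : Set E), h z ∂(μ.comap (↑)) := by
        rw [lintegral_subtype_comap (measurableSet_singleton _).compl, restrict_compl_singleton]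
    _ = ∫⁻ p : sphere (0 : E) 1 × Ioi (0 : ℝ), h ((p.2 : ℝ) • (p.1 : E))
          ∂μ.toSphere.prod (.volumeIoiPow (Module.finrank ℝ E - 1)) := by
        rw [← μ.measurePreserving_homeomorphUnitSphereProd.lintegral_comp hm]
        refine lintegral_congr fun z => ?_
        have : ‖(z : E)‖ ≠ 0 := norm_ne_zero_iff.2 z.2
        simp [smul_smul, this]
    _ = _ := by
        rw [lintegral_prod _ hm.aemeasurable]
        refine lintegral_congr fun x => ?_
        rw [Measure.volumeIoiPow, lintegral_withDensity_eq_lintegral_mul _ (by fun_prop)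
          (by fun_prop), ← lintegral_subtype_comap measurableSet_Ioi]
        rfl

/-- Santaló's inequality for a parallel beam of chords of the unit ball. -/
theorem lintegral_sphere_chord_le [Nontrivial E] (μ : Measure E) [μ.IsAddHaarMeasure] {v : E}
    (hv : ‖v‖ = 1) {g : E → ℝ≥0∞} (hg : Measurable g) :
    (∫⁻ x : sphere (0 : E) 1, if ⟪(x : E), v⟫ ≤ 0 then
        ENNReal.ofReal |⟪(x : E), v⟫| * ∫⁻ t in Ioo 0 (-2 * ⟪(x : E), v⟫), g ((x : E) + t • v)
      else 0 ∂μ.toSphere) ≤ ∫⁻ y in closedBall (0 : E) 1, g y ∂μ := by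
  set A := sphereFlowDomain v
  set J : E → ℝ≥0∞ := fun z => ENNReal.ofReal |(‖z‖ ^ Module.finrank ℝ E)⁻¹ * ⟪z, v⟫|
  have hA : MeasurableSet A := measurableSet_sphereFlowDomain v
  have hm : Measurable (A.indicator fun z => J z * g (sphereFlow v z)) :=
    (Measurable.mul (by fun_prop) (hg.comp (measurable_sphereFlow v))).indicator hA
  have hchange : ∫⁻ z, A.indicator (fun z => J z * g (sphereFlow v z)) z ∂μ =
      ∫⁻ y in sphereFlow v '' A, g y ∂μ := by
    rw [lintegral_image_eq_lintegral_abs_det_fderiv_mul μ hA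
      (fun z hz => (hasFDerivAt_sphereFlow v
        (ne_zero_of_mem_sphereFlowDomain hz)).hasFDerivWithinAt) (injOn_sphereFlow hv),
      lintegral_indicator hA]
    refine setLIntegral_congr_fun hA fun z hz => ?_
    simp only [J, det_sphereFlowDeriv v (ne_zero_of_mem_sphereFlowDomain hz)]
  refine le_trans ?_ (hchange.trans_le (lintegral_mono_set
    (image_subset_iff.2 fun z hz => sphereFlow_mem_closedBall hv hz)))
  rw [lintegral_eq_lintegral_toSphere μ hm]
  refine lintegral_mono fun x => ?_
  have hx : ‖(x : E)‖ = 1 := norm_eq_of_mem_sphere x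
  split_ifs with hxv
  swap
  · exact zero_le
  rw [← lintegral_const_mul _ (by fun_prop)]
  refine le_trans (setLIntegral_mono' measurableSet_Ioo fun t ht => ?_)
    (lintegral_mono_set Ioo_subset_Ioi_self)
  have ht0 : 0 < t := ht.1
  have hlt : ⟪(x : E), v⟫ < 0 := by linarith [ht.1.trans ht.2]
  have hmem : t • (x : E) ∈ A := by
    refine ⟨?_, ?_⟩
    · rw [real_inner_smul_left]
      exact mul_neg_of_pos_of_neg ht0 hlt
    · rw [real_inner_smul_left, norm_smul, hx, mul_one, Real.norm_eq_abs, sq_abs]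
      nlinarith [ht.2]
  rw [indicator_of_mem hmem, sphereFlow_smul hx ht0, ← mul_assoc,
    ← ENNReal.ofReal_mul (by positivity)]
  refine le_of_eq ?_
  congr 2
  obtain ⟨n, hn⟩ : ∃ n, Module.finrank ℝ E = n + 1 :=
    Nat.exists_eq_succ_of_ne_zero Module.finrank_pos.ne'
  rw [hn, norm_smul, hx, mul_one, Real.norm_eq_abs, abs_of_pos ht0, real_inner_smul_left, abs_mul,
    abs_mul, abs_of_pos ht0, abs_of_pos (inv_pos.2 (pow_pos ht0 _)), Nat.add_sub_cancel]
  field_simp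
  ring

end Santalo

theorem exitTime_eq_of_norm_eq_one {d : ℕ} {x v : EuclideanSpace ℝ (Fin d)} (hx : ‖x‖ = 1)
    (hxv : ⟪x, v⟫ ≤ 0) : exitTime x v = -2 * ⟪x, v⟫ := by
  rw [exitTime, hx, one_pow, sub_self, zero_add, Real.sqrt_sq_eq_abs, abs_of_nonpos hxv]
  ring

/-- Lemma 5.6(i) of the paper (Euclidean unit ball case): the X-ray transform is bounded
from the weighted space `L²(B, (1-‖y‖²)^{1/2} dy)` to `L²_μ(∂₊)`. -/
theorem xray_weighted_L2_bounded (d : ℕ) (hd : 2 ≤ d) :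
    ∃ C : ℝ, 0 < C ∧
      ∀ f : EuclideanSpace ℝ (Fin d) → ℝ≥0∞, Measurable f →
        (∫⁻ x : Metric.sphere (0 : EuclideanSpace ℝ (Fin d)) 1,
            ∫⁻ v : Metric.sphere (0 : EuclideanSpace ℝ (Fin d)) 1,
              (if ⟪(x : EuclideanSpace ℝ (Fin d)), (v : EuclideanSpace ℝ (Fin d))⟫ ≤ 0 then
                ENNReal.ofReal
                    |⟪(x : EuclideanSpace ℝ (Fin d)), (v : EuclideanSpace ℝ (Fin d))⟫| *
                  (∫⁻ t in Ioo (0 : ℝ)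
                      (exitTime (x : EuclideanSpace ℝ (Fin d)) (v : EuclideanSpace ℝ (Fin d))),
                    f ((x : EuclideanSpace ℝ (Fin d)) + t • (v : EuclideanSpace ℝ (Fin d)))) ^ 2
              else 0) ∂(sphereMeasure d) ∂(sphereMeasure d))
          ≤ ENNReal.ofReal C *
              ∫⁻ y in Metric.closedBall (0 : EuclideanSpace ℝ (Fin d)) 1,
                (f y) ^ 2 * ENNReal.ofReal (Real.sqrt (1 - ‖y‖ ^ 2)) := by
  have : Nontrivial (EuclideanSpace ℝ (Fin d)) :=
    Module.nontrivial_of_finrank_pos (R := ℝ) (by rw [finrank_euclideanSpace_fin]; omega)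
  have : IsFiniteMeasure (sphereMeasure d) := by
    unfold sphereMeasure
    infer_instance
  refine ⟨4 * ((sphereMeasure d).real univ + 1), by positivity, fun f hf => ?_⟩
  set g : EuclideanSpace ℝ (Fin d) → ℝ≥0∞ :=
    fun y => f y ^ 2 * ENNReal.ofReal (Real.sqrt (1 - ‖y‖ ^ 2)) with hg_def
  have hg : Measurable g := by fun_prop
  set S := Metric.sphere (0 : EuclideanSpace ℝ (Fin d)) 1
  set G : S → S → ℝ≥0∞ := fun x v =>
    if ⟪(x : EuclideanSpace ℝ (Fin d)), (v : EuclideanSpace ℝ (Fin d))⟫ ≤ 0 then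
      ENNReal.ofReal |⟪(x : EuclideanSpace ℝ (Fin d)), (v : EuclideanSpace ℝ (Fin d))⟫| *
        ∫⁻ t in Ioo (0 : ℝ) (-2 * ⟪(x : EuclideanSpace ℝ (Fin d)), (v : EuclideanSpace ℝ (Fin d))⟫),
          g ((x : EuclideanSpace ℝ (Fin d)) + t • (v : EuclideanSpace ℝ (Fin d)))
    else 0 with hG_def
  have hG : Measurable (Function.uncurry G) := by
    refine Measurable.ite (measurableSet_le (by fun_prop) measurable_const) ?_ measurable_const
    refine Measurable.mul (by fun_prop) ?_
    simp only [← lintegral_indicator measurableSet_Ioo]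
    refine Measurable.lintegral_prod_right' (f := fun q : (S × S) × ℝ =>
      (Ioo (0 : ℝ) (-2 * ⟪(q.1.1 : EuclideanSpace ℝ (Fin d)),
        (q.1.2 : EuclideanSpace ℝ (Fin d))⟫)).indicator
        (fun t => g ((q.1.1 : EuclideanSpace ℝ (Fin d)) +
          t • (q.1.2 : EuclideanSpace ℝ (Fin d)))) q.2) ?_
    simp only [indicator_apply]
    exact Measurable.ite ((measurableSet_lt measurable_const measurable_snd).inter
      (measurableSet_lt measurable_snd (by fun_prop))) (by fun_prop) measurable_const
  calc _ ≤ ∫⁻ x : S, ∫⁻ v : S, ENNReal.ofReal 4 * G x v ∂(sphereMeasure d) ∂(sphereMeasure d) := by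
        refine lintegral_mono fun x => lintegral_mono fun v => ?_
        have hx : ‖(x : EuclideanSpace ℝ (Fin d))‖ = 1 := norm_eq_of_mem_sphere x
        have hv : ‖(v : EuclideanSpace ℝ (Fin d))‖ = 1 := norm_eq_of_mem_sphere v
        simp only [hG_def]
        split_ifs with hxv
        swap
        · exact zero_le
        rw [exitTime_eq_of_norm_eq_one hx hxv, mul_left_comm]
        gcongr
        refine (sq_lintegral_chord_le (by fun_prop)).trans_eq ?_
        congr 1
        refine lintegral_congr fun t => ?_
        simp only [hg_def]
        rw [norm_add_smul_sq hv hx]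
        congr 3
        ring
    _ = ENNReal.ofReal 4 * ∫⁻ v : S, ∫⁻ x : S, G x v ∂(sphereMeasure d) ∂(sphereMeasure d) := by
        rw [lintegral_lintegral_swap (hG.const_mul _).aemeasurable,
          ← lintegral_const_mul _ hG.lintegral_prod_left]
        refine lintegral_congr fun v => ?_
        exact lintegral_const_mul _ (hG.comp measurable_prodMk_right)
    _ ≤ ENNReal.ofReal 4 * ∫⁻ _ : S, (∫⁻ y in closedBall 0 1, g y) ∂(sphereMeasure d) := by
        gcongr with v
        exact lintegral_sphere_chord_le volume (norm_eq_of_mem_sphere v) hg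
    _ ≤ _ := by
        rw [lintegral_const, ENNReal.ofReal_mul (by norm_num), mul_assoc,
          mul_comm (∫⁻ y in closedBall 0 1, g y)]
        gcongr
        rw [← ofReal_measureReal]
        exact ENNReal.ofReal_le_ofReal (by linarith)
end
end

section
/- There is a constant C > 0, depending only on the dimension d, such that for every measurable function w : ∂₊ → [0,∞], ∫_{‖x‖<1} ( ∫_{S^{d−1}} w(x − τ(x,−v)v, v) dσ(v) )² (1 − ‖x‖²)^{-1/2} dx ≤ C ∫_{∂₊} w(x,v)² dμ(x,v). That is, the backprojection I*w(x) := ∫_{S^{d−1}} w(x − τ(x,−v)v, v) dσ(v) is bounded from L²_μ(∂₊) to the weighted space L²(B, (1−‖y‖²)^{-1/2} dy). Here, for ‖x‖ < 1 and v ∈ S^{d−1}, the point x − τ(x,−v)v lies on S^{d−1} and the pair (x − τ(x,−v)v, v) belongs to ∂₊. (This is the Euclidean unit-ball case of Lemma 5.6(ii) of the paper.) -/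
open MeasureTheory Metric Set
open scoped RealInnerProductSpace ENNReal

noncomputable section

section Polar

variable {E : Type*} [NormedAddCommGroup E] [InnerProductSpace ℝ E] [FiniteDimensional ℝ E]
  [MeasurableSpace E] [BorelSpace E]

/-- Polar coordinates on the unit ball for functions that depend only on the direction. -/
theorem lintegral_toSphere_eq_finrank_mul [Nontrivial E] {h : E → ℝ≥0∞} (hh : Measurable h) :
    ∫⁻ p : sphere (0 : E) 1, h p ∂(volume : Measure E).toSphere =
      Module.finrank ℝ E * ∫⁻ y : E, (ball 0 1).indicator (fun y ↦ h (‖y‖⁻¹ • y)) y := by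
  have hd : 0 < Module.finrank ℝ E := Module.finrank_pos
  set F : E → ℝ≥0∞ := (ball 0 1).indicator (fun y ↦ h (‖y‖⁻¹ • y)) with hF
  have hmp := (volume : Measure E).measurePreserving_homeomorphUnitSphereProd
  have h1 : ∫⁻ y : E, F y = ∫⁻ y : ({0}ᶜ : Set E), F y
      ∂(Measure.comap Subtype.val volume) := by
    rw [lintegral_subtype_comap (measurableSet_singleton _).compl, restrict_compl_singleton]
  set G : sphere (0 : E) 1 × Ioi (0 : ℝ) → ℝ≥0∞ := fun q ↦ h q.1 *
    (Iio (⟨1, mem_Ioi.2 one_pos⟩ : Ioi (0 : ℝ))).indicator 1 q.2 with hG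
  have h2 : ∀ y : ({0}ᶜ : Set E), F y = G (homeomorphUnitSphereProd E y) := by
    intro y
    by_cases hy : ‖(y : E)‖ < 1
    · have : homeomorphUnitSphereProd E y ∈
          {q : sphere (0 : E) 1 × Ioi (0 : ℝ) | q.2 ∈ Iio (⟨1, mem_Ioi.2 one_pos⟩ : Ioi (0 : ℝ))} := by
        simpa [← Subtype.coe_lt_coe] using hy
      simp only [mem_ofPred_eq] at this
      simp [hF, hG, hy, indicator_of_mem this]
    · have : (homeomorphUnitSphereProd E y).2 ∉ Iio (⟨1, mem_Ioi.2 one_pos⟩ : Ioi (0 : ℝ)) := by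
        simpa [← Subtype.coe_lt_coe] using hy
      simp [hF, hG, hy, indicator_of_notMem this]
  rw [h1, lintegral_congr h2,
    hmp.lintegral_comp_emb (homeomorphUnitSphereProd E).measurableEmbedding G,
    lintegral_prod_mul (f := fun p : sphere (0 : E) 1 ↦ h p)
      (hh.comp measurable_subtype_coe).aemeasurable
      ((measurable_one.indicator measurableSet_Iio).aemeasurable),
    lintegral_indicator_one measurableSet_Iio, Measure.volumeIoiPow_apply_Iio]
  have h3 : (Module.finrank ℝ E : ℝ≥0∞) *
      ENNReal.ofReal ((1 : ℝ) ^ (Module.finrank ℝ E - 1 + 1) /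
        ((Module.finrank ℝ E - 1 : ℕ) + 1)) = 1 := by
    rw [← ENNReal.ofReal_natCast, ← ENNReal.ofReal_mul (by positivity), one_pow,
      Nat.cast_pred hd, sub_add_cancel, mul_one_div_cancel (by positivity), ENNReal.ofReal_one]
  rw [mul_left_comm, h3, mul_one]

/-- Fubini's theorem along the orthogonal splitting `E = ℝ v ⊕ (ℝ v)ᗮ`. -/
theorem lintegral_eq_lintegral_orthogonal_span {v : E} (hv : ‖v‖ = 1) {F : E → ℝ≥0∞}
    (hF : Measurable F) :
    ∫⁻ x, F x = ∫⁻ u : (ℝ ∙ v)ᗮ, ∫⁻ s : ℝ, F (s • v + u) := by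
  have e₁ : MeasurePreserving fun q : ℝ × (ℝ ∙ v)ᗮ ↦
      ((LinearIsometryEquiv.toSpanUnitSingleton (𝕜 := ℝ) v hv q.1, q.2) :
        (ℝ ∙ v) × (ℝ ∙ v)ᗮ) :=
    (LinearIsometryEquiv.toSpanUnitSingleton (𝕜 := ℝ) v hv).measurePreserving.prod
      (MeasurePreserving.id volume)
  have e₂ := WithLp.volume_preserving_toLp ↥(ℝ ∙ v) ↥(ℝ ∙ v)ᗮ
  have e := (ℝ ∙ v).orthogonalDecomposition.symm.measurePreserving.comp (e₂.comp e₁)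
  rw [← e.lintegral_comp hF, Measure.volume_eq_prod, lintegral_prod_symm]
  · rfl
  · exact (hF.comp e.measurable).aemeasurable

theorem lintegral_inv_smul {r : ℝ} (hr : 0 < r) {k : E → ℝ≥0∞} (hk : Measurable k) :
    ∫⁻ z, k (r⁻¹ • z) = ENNReal.ofReal (r ^ Module.finrank ℝ E) * ∫⁻ z, k z := by
  rw [← lintegral_map hk (measurable_const_smul r⁻¹),
    Measure.map_addHaar_smul _ (inv_ne_zero hr.ne'), lintegral_smul_measure]
  congr 2
  rw [inv_pow, inv_inv, abs_of_pos (by positivity)]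

end Polar

/-- Parametrization of the lower half circle by the radius at a fixed height `c`. -/
theorem setLIntegral_neg_sqrt_sq_sub_sq_le {c : ℝ} (hc : 0 ≤ c) (F : ℝ → ℝ≥0∞) :
    ∫⁻ r in Ioo c 1, ENNReal.ofReal (r / √(r ^ 2 - c ^ 2)) * F (-√(r ^ 2 - c ^ 2)) ≤
      ∫⁻ s, F s := by
  have hpos : ∀ r ∈ Ioo c 1, 0 < r ^ 2 - c ^ 2 := fun r hr ↦ by nlinarith [hr.1]
  have hderiv : ∀ r ∈ Ioo c 1, HasDerivWithinAt (fun r ↦ -√(r ^ 2 - c ^ 2))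
      (-(r / √(r ^ 2 - c ^ 2))) (Ioo c 1) r := fun r hr ↦ by
    have h := ((((hasDerivAt_id r).pow 2).sub_const (c ^ 2)).sqrt (hpos r hr).ne').neg
    refine h.hasDerivWithinAt.congr_deriv ?_
    simp only [Pi.pow_apply, id, Nat.cast_ofNat, Nat.add_one_sub_one, pow_one, mul_one]
    rw [mul_div_mul_left _ _ two_ne_zero]
  have hinj : InjOn (fun r ↦ -√(r ^ 2 - c ^ 2)) (Ioo c 1) := fun r hr t ht hrt ↦ by
    have h := (Real.sqrt_inj (hpos r hr).le (hpos t ht).le).1 (neg_injective hrt)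
    exact (pow_left_inj₀ (hc.trans hr.1.le) (hc.trans ht.1.le) two_ne_zero).1 (by linarith)
  calc
    _ = ∫⁻ s in (fun r ↦ -√(r ^ 2 - c ^ 2)) '' Ioo c 1, F s := by
      rw [lintegral_image_eq_lintegral_abs_deriv_mul measurableSet_Ioo hderiv hinj]
      refine setLIntegral_congr_fun measurableSet_Ioo fun r hr ↦ ?_
      have : 0 ≤ r / √(r ^ 2 - c ^ 2) := div_nonneg (hc.trans hr.1.le) (Real.sqrt_nonneg _)
      simp only [abs_neg, abs_of_nonneg this]
    _ ≤ ∫⁻ s, F s := setLIntegral_le_lintegral _ _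

theorem setLIntegral_inv_sqrt_sq_sub_sq_le {a : ℝ} (ha : 0 < a) :
    ∫⁻ s in Ioo (-a) a, ENNReal.ofReal (√(a ^ 2 - s ^ 2))⁻¹ ≤ ENNReal.ofReal Real.pi := by
  have himage : Ioo (-a) a ⊆ (fun θ ↦ a * Real.sin θ) '' Ioo (-(Real.pi / 2)) (Real.pi / 2) := by
    intro s hs
    have h1 : -1 < s / a := by rw [lt_div_iff₀ ha]; linarith [hs.1]
    have h2 : s / a < 1 := by rw [div_lt_one ha]; exact hs.2
    refine ⟨Real.arcsin (s / a), ⟨Real.neg_pi_div_two_lt_arcsin.2 h1,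
      Real.arcsin_lt_pi_div_two.2 h2⟩, ?_⟩
    simp only [Real.sin_arcsin h1.le h2.le]
    field_simp
  have hinj : InjOn (fun θ ↦ a * Real.sin θ) (Ioo (-(Real.pi / 2)) (Real.pi / 2)) :=
    fun x hx y hy hxy ↦ Real.injOn_sin (Ioo_subset_Icc_self hx) (Ioo_subset_Icc_self hy)
      (mul_left_cancel₀ ha.ne' hxy)
  refine (lintegral_mono_set himage).trans ?_
  rw [lintegral_image_eq_lintegral_abs_deriv_mul measurableSet_Ioo
    (fun θ _ ↦ ((Real.hasDerivAt_sin θ).const_mul a).hasDerivWithinAt) hinj,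
    setLIntegral_congr_fun (g := 1) measurableSet_Ioo fun θ hθ ↦ ?_]
  · simp
  · have hcos := mul_pos ha (Real.cos_pos_of_mem_Ioo hθ)
    have : a ^ 2 - (a * Real.sin θ) ^ 2 = (a * Real.cos θ) ^ 2 := by
      rw [mul_pow, mul_pow, Real.cos_sq']; ring
    simp only [Pi.one_apply]
    rw [this, Real.sqrt_sq hcos.le, abs_of_pos hcos, ← ENNReal.ofReal_mul hcos.le,
      mul_inv_cancel₀ hcos.ne', ENNReal.ofReal_one]

section Hemisphere

variable {E : Type*} [NormedAddCommGroup E] [InnerProductSpace ℝ E]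

theorem norm_sq_smul_add_orthogonal {v : E} (hv : ‖v‖ = 1) (s : ℝ) (u : (ℝ ∙ v)ᗮ) :
    ‖s • v + (u : E)‖ ^ 2 = s ^ 2 + ‖u‖ ^ 2 := by
  have h0 : ⟪v, (u : E)⟫ = 0 := Submodule.mem_orthogonal_singleton_iff_inner_right.1 u.2
  rw [norm_add_sq_real, real_inner_smul_left, h0, norm_smul, hv]
  simp

theorem inner_smul_add_orthogonal {v : E} (hv : ‖v‖ = 1) (s : ℝ) (u : (ℝ ∙ v)ᗮ) :
    ⟪s • v + (u : E), v⟫ = s := by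
  have h0 : ⟪(u : E), v⟫ = 0 := Submodule.mem_orthogonal_singleton_iff_inner_left.1 u.2
  rw [inner_add_left, real_inner_smul_left, h0, real_inner_self_eq_norm_sq, hv]
  simp

variable [FiniteDimensional ℝ E] [MeasurableSpace E] [BorelSpace E]

/-- The orthogonal projection of the hemisphere `{⟪p, v⟫ ≤ 0}` to the unit ball of `(ℝ v)ᗮ`
has Jacobian `|⟪p, v⟫|`. -/
theorem setLIntegral_ball_orthogonal_le {v : E} (hv : ‖v‖ = 1) {g : E → ℝ≥0∞}
    (hg : Measurable g) :
    ∫⁻ u : (ℝ ∙ v)ᗮ in ball 0 1, g (-√(1 - ‖u‖ ^ 2) • v + u) ≤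
      ∫⁻ p : sphere (0 : E) 1,
        (if ⟪(p : E), v⟫ ≤ 0 then g p * ENNReal.ofReal |⟪(p : E), v⟫| else 0)
          ∂(volume : Measure E).toSphere := by
  have hv0 : v ≠ 0 := by rintro rfl; simp at hv
  have : Nontrivial E := ⟨⟨v, 0, hv0⟩⟩
  have hinner : Measurable fun p : E ↦ ⟪p, v⟫ := by fun_prop
  set h : E → ℝ≥0∞ := fun p ↦ if ⟪p, v⟫ ≤ 0 then g p * ENNReal.ofReal |⟪p, v⟫| else 0 with hh
  have hmeas : Measurable h :=
    Measurable.ite (measurableSet_le hinner measurable_const)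
      (hg.mul (measurable_norm.comp hinner).ennreal_ofReal) measurable_const
  set H : E → ℝ≥0∞ := (ball 0 1).indicator fun y ↦ h (‖y‖⁻¹ • y) with hH
  have hHmeas : Measurable H :=
    (hmeas.comp (by fun_prop)).indicator measurableSet_ball
  set k : (ℝ ∙ v)ᗮ → ℝ≥0∞ := (ball 0 1).indicator fun u ↦ g (-√(1 - ‖u‖ ^ 2) • v + u) with hk
  have hkmeas : Measurable k := (hg.comp (by fun_prop)).indicator measurableSet_ball
  have hslice : ∀ z : (ℝ ∙ v)ᗮ, ∫⁻ r in Ioo (0 : ℝ) 1, k (r⁻¹ • z) ≤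
      ∫⁻ s : ℝ, H (s • v + z) := by
    intro z
    refine le_trans ?_ (setLIntegral_neg_sqrt_sq_sub_sq_le (norm_nonneg z) _)
    rw [← lintegral_indicator measurableSet_Ioo, ← lintegral_indicator measurableSet_Ioo]
    refine lintegral_mono fun r ↦ ?_
    by_cases hr : r ∈ Ioo (0 : ℝ) 1
    swap
    · simp [indicator_of_notMem hr]
    rw [indicator_of_mem hr]
    have hnorm : ‖r⁻¹ • z‖ = ‖z‖ / r := by
      rw [norm_smul, Real.norm_eq_abs, abs_of_pos (inv_pos.2 hr.1), inv_mul_eq_div]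
    by_cases hz : ‖z‖ < r
    swap
    · have : r⁻¹ • z ∉ ball (0 : (ℝ ∙ v)ᗮ) 1 := by
        rw [mem_ball_zero_iff, hnorm, div_lt_one hr.1]; exact hz
      simp [hk, indicator_of_notMem this]
    have hmem : r⁻¹ • z ∈ ball (0 : (ℝ ∙ v)ᗮ) 1 := by
      rw [mem_ball_zero_iff, hnorm, div_lt_one hr.1]; exact hz
    rw [indicator_of_mem (show r ∈ Ioo ‖z‖ 1 from ⟨hz, hr.2⟩), hk, indicator_of_mem hmem]
    have hpos : 0 < r ^ 2 - ‖z‖ ^ 2 := by nlinarith [norm_nonneg z]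
    have hq : 0 < √(r ^ 2 - ‖z‖ ^ 2) := Real.sqrt_pos.2 hpos
    have hny : ‖-√(r ^ 2 - ‖z‖ ^ 2) • v + (z : E)‖ = r := by
      refine (pow_left_inj₀ (norm_nonneg _) hr.1.le two_ne_zero).1 ?_
      rw [norm_sq_smul_add_orthogonal hv, neg_sq, Real.sq_sqrt hpos.le]
      ring
    have hsqrt : √(1 - ‖r⁻¹ • z‖ ^ 2) = r⁻¹ * √(r ^ 2 - ‖z‖ ^ 2) := by
      have : 1 - ‖r⁻¹ • z‖ ^ 2 = (r ^ 2 - ‖z‖ ^ 2) / r ^ 2 := by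
        have := hr.1.ne'
        rw [hnorm]; field_simp
      rw [this, Real.sqrt_div hpos.le, Real.sqrt_sq hr.1.le, inv_mul_eq_div]
    have hpt : r⁻¹ • (-√(r ^ 2 - ‖z‖ ^ 2) • v + (z : E)) =
        -√(1 - ‖r⁻¹ • z‖ ^ 2) • v + ((r⁻¹ • z : (ℝ ∙ v)ᗮ) : E) := by
      rw [hsqrt, smul_add, smul_smul, mul_neg]
      rfl
    have hin : ⟪r⁻¹ • (-√(r ^ 2 - ‖z‖ ^ 2) • v + (z : E)), v⟫ =
        -(√(r ^ 2 - ‖z‖ ^ 2) / r) := by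
      rw [real_inner_smul_left, inner_smul_add_orthogonal hv]
      ring
    have hmemy : -√(r ^ 2 - ‖z‖ ^ 2) • v + (z : E) ∈ ball (0 : E) 1 := by
      rw [mem_ball_zero_iff, hny]; exact hr.2
    have hquot : 0 < √(r ^ 2 - ‖z‖ ^ 2) / r := div_pos hq hr.1
    rw [hH, indicator_of_mem hmemy, hny]
    simp only [hh]
    rw [hin, if_pos (neg_nonpos.2 hquot.le), abs_neg, abs_of_pos hquot, hpt, mul_left_comm,
      ← ENNReal.ofReal_mul (div_pos hr.1 hq).le, div_mul_div_cancel₀ hq.ne', div_self hr.1.ne',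
      ENNReal.ofReal_one, mul_one]
  have hfin : Module.finrank ℝ E = Module.finrank ℝ (ℝ ∙ v)ᗮ + 1 := by
    rw [← (ℝ ∙ v).finrank_add_finrank_orthogonal, finrank_span_singleton hv0, add_comm]
  have hrad : (Module.finrank ℝ E : ℝ≥0∞) *
      ∫⁻ r in Ioo (0 : ℝ) 1, ENNReal.ofReal (r ^ Module.finrank ℝ (ℝ ∙ v)ᗮ) = 1 := by
    rw [Measure.restrict_congr_set Ioo_ae_eq_Ioc,
      ← ofReal_integral_eq_lintegral_ofReal (intervalIntegral.intervalIntegrable_pow _).1,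
      ← intervalIntegral.integral_of_le zero_le_one, ← ENNReal.ofReal_natCast,
      ← ENNReal.ofReal_mul (by positivity), integral_pow, hfin]
    · have : ((Module.finrank ℝ (ℝ ∙ v)ᗮ : ℝ) + 1) ≠ 0 := by positivity
      simp [this]
    · filter_upwards [ae_restrict_mem measurableSet_Ioc] with r hr
      exact pow_nonneg hr.1.le _
  calc
    _ = ∫⁻ u, k u := (lintegral_indicator measurableSet_ball _).symm
    _ = Module.finrank ℝ E * ∫⁻ r in Ioo (0 : ℝ) 1,
          ENNReal.ofReal (r ^ Module.finrank ℝ (ℝ ∙ v)ᗮ) * ∫⁻ u, k u := by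
      rw [lintegral_mul_const _ (by fun_prop), ← mul_assoc, hrad, one_mul]
    _ = Module.finrank ℝ E * ∫⁻ z, ∫⁻ r in Ioo (0 : ℝ) 1, k (r⁻¹ • z) := by
      rw [lintegral_lintegral_swap (by fun_prop)]
      congr 1
      exact setLIntegral_congr_fun measurableSet_Ioo fun r hr ↦
        (lintegral_inv_smul hr.1 hkmeas).symm
    _ ≤ Module.finrank ℝ E * ∫⁻ z : (ℝ ∙ v)ᗮ, ∫⁻ s : ℝ, H (s • v + z) := by
      exact mul_le_mul' le_rfl (lintegral_mono hslice)
    _ = ∫⁻ p : sphere (0 : E) 1, h p ∂(volume : Measure E).toSphere := by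
      rw [lintegral_toSphere_eq_finrank_mul hmeas, lintegral_eq_lintegral_orthogonal_span hv hHmeas]

end Hemisphere

theorem norm_sub_exitTime_smul {d : ℕ} {x v : EuclideanSpace ℝ (Fin d)} (hx : ‖x‖ < 1)
    (hv : ‖v‖ = 1) :
    ‖x - exitTime x (-v) • v‖ = 1 ∧ ⟪x - exitTime x (-v) • v, v⟫ ≤ 0 := by
  have hpos : 0 ≤ 1 - ‖x‖ ^ 2 + ⟪x, v⟫ ^ 2 := by nlinarith [norm_nonneg x, sq_nonneg ⟪x, v⟫]
  have hsq := Real.sq_sqrt hpos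
  have ht : exitTime x (-v) = ⟪x, v⟫ + √(1 - ‖x‖ ^ 2 + ⟪x, v⟫ ^ 2) := by simp [exitTime]
  refine ⟨(pow_left_inj₀ (norm_nonneg _) zero_le_one two_ne_zero).1 ?_, ?_⟩
  · rw [norm_sub_sq_real, real_inner_smul_right, norm_smul, hv, Real.norm_eq_abs, mul_one, sq_abs,
      ht]
    linear_combination hsq
  · rw [inner_sub_left, real_inner_smul_left, real_inner_self_eq_norm_sq, hv, ht]
    linarith [Real.sqrt_nonneg (1 - ‖x‖ ^ 2 + ⟪x, v⟫ ^ 2)]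

/-- Integration of the weight `(1 - ‖x‖²)^{-1/2}` along the chords parallel to `v`. -/
theorem setLIntegral_ball_entryPoint_le {d : ℕ} {v : EuclideanSpace ℝ (Fin d)} (hv : ‖v‖ = 1)
    {g : EuclideanSpace ℝ (Fin d) → ℝ≥0∞} (hg : Measurable g) :
    ∫⁻ x in ball (0 : EuclideanSpace ℝ (Fin d)) 1,
        g (x - exitTime x (-v) • v) * ENNReal.ofReal (√(1 - ‖x‖ ^ 2))⁻¹ ≤
      ENNReal.ofReal Real.pi *
        ∫⁻ u : (ℝ ∙ v)ᗮ in ball 0 1, g (-√(1 - ‖u‖ ^ 2) • v + u) := by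
  have hτ : Measurable fun x : EuclideanSpace ℝ (Fin d) ↦ exitTime x (-v) := by
    unfold exitTime; fun_prop
  have hmeas : Measurable fun x : EuclideanSpace ℝ (Fin d) ↦
      g (x - exitTime x (-v) • v) * ENNReal.ofReal (√(1 - ‖x‖ ^ 2))⁻¹ := by fun_prop
  have hkmeas : Measurable fun u : (ℝ ∙ v)ᗮ ↦ g (-√(1 - ‖u‖ ^ 2) • v + u) :=
    hg.comp (by fun_prop)
  rw [← lintegral_indicator measurableSet_ball,
    lintegral_eq_lintegral_orthogonal_span hv (hmeas.indicator measurableSet_ball),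
    ← lintegral_const_mul _ hkmeas, ← lintegral_indicator measurableSet_ball]
  refine lintegral_mono fun u ↦ ?_
  by_cases hu : u ∈ ball (0 : (ℝ ∙ v)ᗮ) 1
  swap
  · rw [indicator_of_notMem hu, nonpos_iff_eq_zero, ← lintegral_zero (α := ℝ) (μ := volume)]
    refine lintegral_congr fun s ↦ indicator_of_notMem ?_ _
    rw [mem_ball_zero_iff, ← sq_lt_one_iff₀ (norm_nonneg _)] at hu ⊢
    rw [norm_sq_smul_add_orthogonal hv]
    nlinarith [sq_nonneg s]
  rw [indicator_of_mem hu]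
  have hpos : 0 < 1 - ‖u‖ ^ 2 := by
    rw [mem_ball_zero_iff] at hu
    nlinarith [norm_nonneg u]
  have ha : 0 < √(1 - ‖u‖ ^ 2) := Real.sqrt_pos.2 hpos
  have hslice : ∀ s : ℝ, (ball (0 : EuclideanSpace ℝ (Fin d)) 1).indicator (fun x ↦
      g (x - exitTime x (-v) • v) * ENNReal.ofReal (√(1 - ‖x‖ ^ 2))⁻¹) (s • v + u) ≤
        (Ioo (-√(1 - ‖u‖ ^ 2)) (√(1 - ‖u‖ ^ 2))).indicator (fun s ↦
          g (-√(1 - ‖u‖ ^ 2) • v + u) *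
            ENNReal.ofReal (√(√(1 - ‖u‖ ^ 2) ^ 2 - s ^ 2))⁻¹) s := by
    intro s
    by_cases hs : s • v + (u : EuclideanSpace ℝ (Fin d)) ∈ ball (0 : EuclideanSpace ℝ (Fin d)) 1
    swap
    · rw [indicator_of_notMem hs]
      exact zero_le
    have hnorm := norm_sq_smul_add_orthogonal hv s u
    have hs' : s ∈ Ioo (-√(1 - ‖u‖ ^ 2)) (√(1 - ‖u‖ ^ 2)) := by
      rw [mem_ball_zero_iff, ← sq_lt_one_iff₀ (norm_nonneg _), hnorm] at hs
      exact abs_lt.1 (Real.lt_sqrt_of_sq_lt (by rw [sq_abs]; linarith))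
    have hτs : exitTime (s • v + (u : EuclideanSpace ℝ (Fin d))) (-v) =
        s + √(1 - ‖u‖ ^ 2) := by
      rw [exitTime, inner_neg_right, inner_smul_add_orthogonal hv, hnorm, neg_neg, neg_sq]
      ring_nf
    have hpt : s • v + (u : EuclideanSpace ℝ (Fin d)) - (s + √(1 - ‖u‖ ^ 2)) • v =
        -√(1 - ‖u‖ ^ 2) • v + u := by module
    rw [indicator_of_mem hs, indicator_of_mem hs', hτs, hpt, hnorm, Real.sq_sqrt hpos.le,
      sub_add_eq_sub_sub_swap]
  refine (lintegral_mono hslice).trans ?_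
  rw [lintegral_indicator measurableSet_Ioo, lintegral_const_mul _ (by fun_prop), mul_comm]
  exact mul_le_mul' (setLIntegral_inv_sqrt_sq_sub_sq_le ha) le_rfl

theorem sq_lintegral_le_measure_univ_mul {α : Type*} [MeasurableSpace α] (μ : Measure α)
    {f : α → ℝ≥0∞} (hf : Measurable f) :
    (∫⁻ a, f a ∂μ) ^ 2 ≤ μ univ * ∫⁻ a, f a ^ 2 ∂μ := by
  have h := ENNReal.lintegral_mul_le_Lp_mul_Lq μ Real.HolderConjugate.two_two
    hf.aemeasurable (aemeasurable_const (b := (1 : ℝ≥0∞)))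
  have h2 := pow_le_pow_left' h 2
  have hhalf : (1 / 2 * ((2 : ℕ) : ℝ)) = 1 := by norm_num
  simp only [Pi.mul_apply, mul_one, ENNReal.rpow_ofNat, one_pow, lintegral_one, mul_pow,
    ← ENNReal.rpow_mul_natCast] at h2
  rwa [hhalf, ENNReal.rpow_one, ENNReal.rpow_one, mul_comm] at h2

/-- Lemma 5.6(ii) of the paper (Euclidean unit ball case): the backprojection
`I*w(x) = ∫_{S^{d-1}} w(x - τ(x,-v)v, v) dσ(v)` is bounded from `L²_μ(∂₊)` to the
weighted space `L²(B, (1-‖y‖²)^{-1/2} dy)`. Moreover, for `‖x‖ < 1` and `v ∈ S^{d-1}`,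
the point `x - τ(x,-v)v` lies on the unit sphere and `(x - τ(x,-v)v, v) ∈ ∂₊`. -/
theorem backprojection_weighted_L2_bounded (d : ℕ) (hd : 2 ≤ d) :
    (∀ x : EuclideanSpace ℝ (Fin d), ‖x‖ < 1 →
      ∀ v : EuclideanSpace ℝ (Fin d), ‖v‖ = 1 →
        ‖x - exitTime x (-v) • v‖ = 1 ∧ ⟪x - exitTime x (-v) • v, v⟫ ≤ 0) ∧
    ∃ C : ℝ, 0 < C ∧
      ∀ w : EuclideanSpace ℝ (Fin d) → EuclideanSpace ℝ (Fin d) → ℝ≥0∞,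
        Measurable (fun p : EuclideanSpace ℝ (Fin d) × EuclideanSpace ℝ (Fin d) => w p.1 p.2) →
        (∫⁻ x in Metric.ball (0 : EuclideanSpace ℝ (Fin d)) 1,
            (∫⁻ v : Metric.sphere (0 : EuclideanSpace ℝ (Fin d)) 1,
              w (x - exitTime x (-(v : EuclideanSpace ℝ (Fin d))) • (v : EuclideanSpace ℝ (Fin d)))
                (v : EuclideanSpace ℝ (Fin d)) ∂(sphereMeasure d)) ^ 2 *
              ENNReal.ofReal ((Real.sqrt (1 - ‖x‖ ^ 2))⁻¹))
          ≤ ENNReal.ofReal C *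
              ∫⁻ x : Metric.sphere (0 : EuclideanSpace ℝ (Fin d)) 1,
                ∫⁻ v : Metric.sphere (0 : EuclideanSpace ℝ (Fin d)) 1,
                  (if ⟪(x : EuclideanSpace ℝ (Fin d)), (v : EuclideanSpace ℝ (Fin d))⟫ ≤ 0 then
                    (w (x : EuclideanSpace ℝ (Fin d)) (v : EuclideanSpace ℝ (Fin d))) ^ 2 *
                      ENNReal.ofReal
                        |⟪(x : EuclideanSpace ℝ (Fin d)), (v : EuclideanSpace ℝ (Fin d))⟫|
                  else 0) ∂(sphereMeasure d) ∂(sphereMeasure d) := by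
  refine ⟨fun x hx v hv ↦ norm_sub_exitTime_smul hx hv, ?_⟩
  have : IsFiniteMeasure (sphereMeasure d) := by unfold sphereMeasure; infer_instance
  refine ⟨(sphereMeasure d).real univ * Real.pi + 1, by positivity, fun w hw ↦ ?_⟩
  have hw₁ : ∀ v, Measurable fun p ↦ w p v := fun v ↦ hw.comp measurable_prodMk_right
  have hI : Measurable fun q : EuclideanSpace ℝ (Fin d) × sphere (0 : EuclideanSpace ℝ (Fin d)) 1 ↦
      w (q.1 - exitTime q.1 (-(q.2 : EuclideanSpace ℝ (Fin d))) • (q.2 : EuclideanSpace ℝ (Fin d)))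
        q.2 := by
    have hmap : Measurable fun q : EuclideanSpace ℝ (Fin d) ×
        sphere (0 : EuclideanSpace ℝ (Fin d)) 1 ↦
          (q.1 - exitTime q.1 (-(q.2 : EuclideanSpace ℝ (Fin d))) •
            (q.2 : EuclideanSpace ℝ (Fin d)), (q.2 : EuclideanSpace ℝ (Fin d))) := by
      unfold exitTime
      fun_prop
    exact hw.comp hmap
  have hW : Measurable fun x : EuclideanSpace ℝ (Fin d) ↦
      ENNReal.ofReal (√(1 - ‖x‖ ^ 2))⁻¹ := by fun_prop
  set R : sphere (0 : EuclideanSpace ℝ (Fin d)) 1 →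
      sphere (0 : EuclideanSpace ℝ (Fin d)) 1 → ℝ≥0∞ :=
    fun x v ↦ if ⟪(x : EuclideanSpace ℝ (Fin d)), (v : EuclideanSpace ℝ (Fin d))⟫ ≤ 0 then
      w x v ^ 2 * ENNReal.ofReal
        |⟪(x : EuclideanSpace ℝ (Fin d)), (v : EuclideanSpace ℝ (Fin d))⟫| else 0
  have hR : Measurable (Function.uncurry R) := by
    have hinner : Measurable fun q : sphere (0 : EuclideanSpace ℝ (Fin d)) 1 ×
        sphere (0 : EuclideanSpace ℝ (Fin d)) 1 ↦
          ⟪(q.1 : EuclideanSpace ℝ (Fin d)), (q.2 : EuclideanSpace ℝ (Fin d))⟫ := by fun_prop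
    have hcoe : Measurable fun q : sphere (0 : EuclideanSpace ℝ (Fin d)) 1 ×
        sphere (0 : EuclideanSpace ℝ (Fin d)) 1 ↦
          ((q.1 : EuclideanSpace ℝ (Fin d)), (q.2 : EuclideanSpace ℝ (Fin d))) := by fun_prop
    exact Measurable.ite (measurableSet_le hinner measurable_const)
      (((hw.comp hcoe).pow_const 2).mul (measurable_norm.comp hinner).ennreal_ofReal)
      measurable_const
  calc
    _ ≤ ∫⁻ x in ball (0 : EuclideanSpace ℝ (Fin d)) 1,
          sphereMeasure d univ * ∫⁻ v : sphere (0 : EuclideanSpace ℝ (Fin d)) 1,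
            w (x - exitTime x (-(v : EuclideanSpace ℝ (Fin d))) • (v : EuclideanSpace ℝ (Fin d)))
              v ^ 2 * ENNReal.ofReal (√(1 - ‖x‖ ^ 2))⁻¹ ∂sphereMeasure d := by
      refine lintegral_mono fun x ↦ ?_
      have hx := hI.comp (measurable_prodMk_left (x := x))
      simp only [Function.comp_def] at hx
      rw [lintegral_mul_const _ (hx.pow_const 2), ← mul_assoc]
      exact mul_le_mul' (sq_lintegral_le_measure_univ_mul _ hx) le_rfl
    _ = sphereMeasure d univ * ∫⁻ v : sphere (0 : EuclideanSpace ℝ (Fin d)) 1,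
          (∫⁻ x in ball (0 : EuclideanSpace ℝ (Fin d)) 1,
            w (x - exitTime x (-(v : EuclideanSpace ℝ (Fin d))) • (v : EuclideanSpace ℝ (Fin d)))
              v ^ 2 * ENNReal.ofReal (√(1 - ‖x‖ ^ 2))⁻¹) ∂sphereMeasure d := by
      have hJ : Measurable (Function.uncurry fun (x : EuclideanSpace ℝ (Fin d))
          (v : sphere (0 : EuclideanSpace ℝ (Fin d)) 1) ↦
            w (x - exitTime x (-(v : EuclideanSpace ℝ (Fin d))) • (v : EuclideanSpace ℝ (Fin d)))
              v ^ 2 * ENNReal.ofReal (√(1 - ‖x‖ ^ 2))⁻¹) :=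
        (hI.pow_const 2).mul (hW.comp measurable_fst)
      rw [← lintegral_lintegral_swap hJ.aemeasurable]
      exact lintegral_const_mul _ hJ.lintegral_prod_right'
    _ ≤ sphereMeasure d univ * ∫⁻ v : sphere (0 : EuclideanSpace ℝ (Fin d)) 1,
          ENNReal.ofReal Real.pi * ∫⁻ x, R x v ∂sphereMeasure d ∂sphereMeasure d := by
      refine mul_le_mul' le_rfl (lintegral_mono fun v ↦ ?_)
      have hv : ‖(v : EuclideanSpace ℝ (Fin d))‖ = 1 := norm_eq_of_mem_sphere v
      have hg := (hw₁ v).pow_const 2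
      exact (setLIntegral_ball_entryPoint_le hv hg).trans
        (mul_le_mul' le_rfl (setLIntegral_ball_orthogonal_le hv hg))
    _ ≤ _ := by
      have hRv : Measurable fun v ↦ ∫⁻ x, R x v ∂sphereMeasure d := hR.lintegral_prod_left'
      rw [lintegral_const_mul _ hRv, ← mul_assoc, ← lintegral_lintegral_swap hR.aemeasurable]
      refine mul_le_mul' ?_ le_rfl
      rw [← ofReal_measureReal, ← ENNReal.ofReal_mul measureReal_nonneg]
      exact ENNReal.ofReal_le_ofReal (by linarith)
end
end

section
/- Define g : [0,1] → ℝ by g(r) := ∫_0^{2π} √(1 − r² sin²θ) dθ. Then g(1) = 4 and (g(r) − 4)/(1 − r) → +∞ as r → 1⁻. In particular g is not Lipschitz on [0,1], and consequently the function N(1) on the closed unit disk (whose value at x is 2 g(‖x‖)) is not continuously differentiable up to the boundary of the disk; in particular N(1) ∉ C^∞ of the closed disk. (This is the boundary non-smoothness of N(1) asserted in Section 5.1 of the paper, showing the normal operator cannot satisfy the classical transmission condition.) -/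
open MeasureTheory Metric Set Filter
open scoped Real Topology NNReal

noncomputable section

/-- The radial profile of (half of) `N(1)` on the unit disk:
`g(r) = ∫_0^{2π} √(1 - r² sin²θ) dθ`, so that `N(1)(x) = 2 g(‖x‖)`. -/
def gProfile (r : ℝ) : ℝ :=
  ∫ θ in Set.Ioo (0 : ℝ) (2 * π), Real.sqrt (1 - r ^ 2 * Real.sin θ ^ 2)

/-- At `r = 1` the integrand is `|cos θ|`, with total integral `4`. -/
theorem gProfile_one : gProfile 1 = 4 := by
  have hcos : ∀ θ : ℝ, Real.sqrt (1 - 1 ^ 2 * Real.sin θ ^ 2) = |Real.cos θ| := fun θ => by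
    rw [← Real.sqrt_sq_eq_abs, Real.cos_sq']
    ring_nf
  have hint : ∀ a b : ℝ, IntervalIntegrable (fun θ => |Real.cos θ|) volume a b := fun a b =>
    (by fun_prop : Continuous fun θ : ℝ => |Real.cos θ|).intervalIntegrable a b
  have hpi := Real.pi_pos
  have h1 : ∫ θ in (0 : ℝ)..(π / 2), |Real.cos θ| = 1 := by
    rw [intervalIntegral.integral_congr (g := Real.cos), integral_cos]
    · simp
    · intro θ hθ
      rw [uIcc_of_le (by positivity)] at hθ
      exact abs_of_nonneg (Real.cos_nonneg_of_mem_Icc ⟨by linarith [hθ.1], hθ.2⟩)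
  have h2 : ∫ θ in (π / 2)..π, |Real.cos θ| = 1 := by
    rw [← h1]
    have h := intervalIntegral.integral_comp_sub_left (a := 0) (b := π / 2)
      (fun θ => |Real.cos θ|) π
    simp only [Real.cos_pi_sub, abs_neg, sub_zero] at h
    rw [h]
    congr 1
    ring
  have h3 : ∫ θ in (0 : ℝ)..π, |Real.cos θ| = 2 := by
    rw [← intervalIntegral.integral_add_adjacent_intervals (hint 0 (π / 2)) (hint _ _), h1, h2]
    norm_num
  have h4 : ∫ θ in π..(2 * π), |Real.cos θ| = 2 := by
    rw [two_mul, ← h3]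
    have h := intervalIntegral.integral_comp_add_right (a := 0) (b := π)
      (fun θ => |Real.cos θ|) π
    simp only [Real.cos_add_pi, abs_neg, zero_add] at h
    exact h.symm
  simp only [gProfile, hcos]
  rw [← integral_Ioc_eq_integral_Ioo, ← intervalIntegral.integral_of_le (by positivity),
    ← intervalIntegral.integral_add_adjacent_intervals (hint 0 π) (hint _ _), h3, h4]
  norm_num

/-- Rationalised lower bound for the difference of two square roots. -/
theorem div_le_sqrt_add_sq_sub {a c s : ℝ} (ha : 0 ≤ a) (hc : 0 < c) (hs : 1 / 2 ≤ s) {t : ℝ}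
    (hat : a ≤ t) :
    c ^ 2 / 4 * (2 * t + c)⁻¹ ≤ Real.sqrt (a ^ 2 + c ^ 2 * s ^ 2) - a := by
  have hden : 0 < 2 * t + c := by linarith
  set q := c ^ 2 / 4 * (2 * t + c)⁻¹ with hq
  have hq0 : 0 ≤ q := by positivity
  have hmul : q * (2 * t + c) = c ^ 2 / 4 := by
    rw [hq]
    field_simp
  have hqc : q ≤ c := by nlinarith
  have hs2 : 1 / 4 ≤ s ^ 2 := by nlinarith
  suffices a + q ≤ Real.sqrt (a ^ 2 + c ^ 2 * s ^ 2) by linarith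
  apply Real.le_sqrt_of_sq_le
  have h1 : q * (2 * a + q) ≤ q * (2 * t + c) := by gcongr
  nlinarith [mul_le_mul_of_nonneg_left hs2 (sq_nonneg c)]

theorem integral_inv_two_mul_sub_add {c : ℝ} (hc : 0 < c) (b : ℝ) :
    ∫ θ in (b - 1)..b, (2 * (b - θ) + c)⁻¹ = (Real.log (2 + c) - Real.log c) / 2 := by
  have hpos : ∀ θ ∈ uIcc (b - 1) b, 2 * (b - θ) + c ≠ 0 := fun θ hθ => by
    rw [uIcc_of_le (by linarith)] at hθ
    linarith [hθ.2]
  rw [intervalIntegral.integral_eq_sub_of_hasDerivAt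
    (f := fun θ => -(Real.log (2 * (b - θ) + c) / 2))]
  · simp
    ring
  · intro θ hθ
    have h : HasDerivAt (fun θ : ℝ => 2 * (b - θ) + c) (2 * (-1)) θ :=
      (((hasDerivAt_id θ).const_sub b).const_mul 2).add_const c
    have h' := ((h.log (hpos θ hθ)).div_const 2).fun_neg
    rwa [show -(2 * (-1) / (2 * (b - θ) + c) / 2) = (2 * (b - θ) + c)⁻¹ by
      rw [inv_eq_one_div]; ring] at h'
  · exact (ContinuousOn.inv₀ (by fun_prop) hpos).intervalIntegrable

/-- Logarithmic lower bound for `g(r) - 4`, coming from angles just below `π / 2`. -/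
theorem mul_log_le_gProfile_sub {r : ℝ} (hr0 : 0 ≤ r) (hr : r < 1) :
    (1 - r) * ((Real.log 2 - Real.log (Real.sqrt (1 - r ^ 2))) / 8) ≤ gProfile r - 4 := by
  have hr2 : 0 < 1 - r ^ 2 := by nlinarith
  set c := Real.sqrt (1 - r ^ 2)
  have hc : 0 < c := Real.sqrt_pos.2 hr2
  have hc2 : c ^ 2 = 1 - r ^ 2 := Real.sq_sqrt hr2.le
  have hc1 : c ≤ 2 := by nlinarith
  have hpi := Real.pi_gt_three
  set D : ℝ → ℝ := fun θ =>
    Real.sqrt (1 - r ^ 2 * Real.sin θ ^ 2) - Real.sqrt (1 - 1 ^ 2 * Real.sin θ ^ 2) with hD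
  have hDcont : Continuous D := by fun_prop
  have hDnonneg : ∀ θ, 0 ≤ D θ := fun θ => by
    refine sub_nonneg.2 (Real.sqrt_le_sqrt ?_)
    nlinarith [mul_nonneg hr2.le (sq_nonneg (Real.sin θ))]
  have hDint : IntegrableOn D (Ioo 0 (2 * π)) :=
    (hDcont.integrableOn_Icc).mono_set Ioo_subset_Icc_self
  have hdiff : gProfile r - 4 = ∫ θ in Ioo 0 (2 * π), D θ := by
    rw [← gProfile_one, gProfile, gProfile, ← integral_sub]
    · exact (Continuous.integrableOn_Icc (by fun_prop)).mono_set Ioo_subset_Icc_self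
    · exact (Continuous.integrableOn_Icc (by fun_prop)).mono_set Ioo_subset_Icc_self
  have hle : ∫ θ in (π / 2 - 1)..(π / 2), D θ ≤ gProfile r - 4 := by
    rw [hdiff, intervalIntegral.integral_of_le (by linarith)]
    refine setIntegral_mono_set hDint (ae_of_all _ hDnonneg) (LE.le.eventuallyLE ?_)
    exact fun θ hθ => ⟨by linarith [hθ.1], by linarith [hθ.2]⟩
  have hpt : ∀ θ ∈ Icc (π / 2 - 1) (π / 2), c ^ 2 / 4 * (2 * (π / 2 - θ) + c)⁻¹ ≤ D θ := by
    intro θ hθ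
    have hcos : 0 ≤ Real.cos θ := Real.cos_nonneg_of_mem_Icc ⟨by linarith [hθ.1], hθ.2⟩
    have hsin : 1 / 2 ≤ Real.sin θ := by
      rw [← Real.cos_pi_div_two_sub]
      have h := Real.one_sub_sq_div_two_le_cos (x := π / 2 - θ)
      nlinarith [hθ.1, hθ.2]
    have hcos_le : Real.cos θ ≤ π / 2 - θ := by
      rw [← Real.sin_pi_div_two_sub]
      exact Real.sin_le (by linarith [hθ.2])
    have h := div_le_sqrt_add_sq_sub hcos hc hsin hcos_le
    have h1 : 1 - r ^ 2 * Real.sin θ ^ 2 = Real.cos θ ^ 2 + c ^ 2 * Real.sin θ ^ 2 := by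
      rw [hc2, Real.cos_sq']
      ring
    have h2 : 1 - 1 ^ 2 * Real.sin θ ^ 2 = Real.cos θ ^ 2 := by
      rw [Real.cos_sq']
      ring
    simpa only [hD, h1, h2, Real.sqrt_sq hcos] using h
  have hpos : ∀ θ ∈ uIcc (π / 2 - 1) (π / 2), 2 * (π / 2 - θ) + c ≠ 0 := fun θ hθ => by
    rw [uIcc_of_le (by linarith)] at hθ
    linarith [hθ.2]
  have hmono : ∫ θ in (π / 2 - 1)..(π / 2), c ^ 2 / 4 * (2 * (π / 2 - θ) + c)⁻¹ ≤
      ∫ θ in (π / 2 - 1)..(π / 2), D θ := intervalIntegral.integral_mono_on (μ := volume) (by linarith)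
    (ContinuousOn.intervalIntegrable
      (continuousOn_const.mul (ContinuousOn.inv₀ (by fun_prop) hpos)))
    (hDcont.intervalIntegrable _ _) hpt
  rw [intervalIntegral.integral_const_mul, integral_inv_two_mul_sub_add hc] at hmono
  refine le_trans ?_ (hmono.trans hle)
  have hlog2 : Real.log 2 ≤ Real.log (2 + c) := Real.log_le_log (by norm_num) (by linarith)
  have hlogc : Real.log c ≤ Real.log 2 := Real.log_le_log hc hc1
  have hrc : 1 - r ≤ c ^ 2 := by nlinarith
  calc (1 - r) * ((Real.log 2 - Real.log c) / 8)
      ≤ c ^ 2 * ((Real.log (2 + c) - Real.log c) / 8) := by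
        gcongr
    _ = c ^ 2 / 4 * ((Real.log (2 + c) - Real.log c) / 2) := by ring

theorem tendsto_gProfile_sub_div :
    Tendsto (fun r => (gProfile r - 4) / (1 - r)) (𝓝[<] (1 : ℝ)) atTop := by
  have hmem : Ioo (0 : ℝ) 1 ∈ 𝓝[<] (1 : ℝ) := Ioo_mem_nhdsLT one_pos
  have hsqrt : Tendsto (fun r : ℝ => Real.sqrt (1 - r ^ 2)) (𝓝[<] 1) (𝓝[≠] 0) := by
    refine tendsto_nhdsWithin_iff.2 ⟨?_, ?_⟩
    · have h : Continuous fun r : ℝ => Real.sqrt (1 - r ^ 2) := by fun_prop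
      simpa using (h.tendsto 1).mono_left nhdsWithin_le_nhds
    · filter_upwards [hmem] with r hr
      exact (Real.sqrt_pos.2 (by nlinarith [hr.1, hr.2])).ne'
  have hlog : Tendsto (fun r : ℝ => (Real.log 2 - Real.log (Real.sqrt (1 - r ^ 2))) / 8)
      (𝓝[<] 1) atTop :=
    (tendsto_atTop_add_const_left _ (Real.log 2)
      (tendsto_neg_atBot_atTop.comp (Real.tendsto_log_nhdsNE_zero.comp hsqrt))).atTop_div_const
      (by norm_num)
  refine tendsto_atTop_mono' _ ?_ hlog
  filter_upwards [hmem] with r hr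
  rw [le_div_iff₀ (by linarith [hr.2]), mul_comm]
  exact mul_log_le_gProfile_sub hr.1.le hr.2

theorem not_lipschitzOnWith_gProfile (K : ℝ≥0) :
    ¬ LipschitzOnWith K gProfile (Icc (0 : ℝ) 1) := by
  intro hL
  obtain ⟨r, hr, hK⟩ := (Filter.Eventually.and (Ioo_mem_nhdsLT (zero_lt_one' ℝ))
    (tendsto_gProfile_sub_div.eventually_gt_atTop (K : ℝ))).exists
  have h := hL.dist_le_mul r ⟨hr.1.le, hr.2.le⟩ 1 ⟨zero_le_one, le_rfl⟩
  rw [Real.dist_eq, Real.dist_eq, gProfile_one, abs_sub_comm r 1,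
    abs_of_pos (sub_pos.2 hr.2)] at h
  rw [lt_div_iff₀ (sub_pos.2 hr.2)] at hK
  linarith [le_abs_self (gProfile r - 4)]

theorem not_differentiable_of_eq_gProfile_norm {F : EuclideanSpace ℝ (Fin 2) → ℝ}
    (hF : ∀ x ∈ closedBall (0 : EuclideanSpace ℝ (Fin 2)) 1, F x = 2 * gProfile ‖x‖) :
    ¬ Differentiable ℝ F := by
  intro hdiff
  set e : EuclideanSpace ℝ (Fin 2) := EuclideanSpace.single 0 1
  have he : ‖e‖ = 1 := by simp [e]
  have hval : ∀ r ∈ Icc (0 : ℝ) 1, F (r • e) = 2 * gProfile r := fun r hr => by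
    have hnorm : ‖r • e‖ = r := by rw [norm_smul, he, mul_one, Real.norm_of_nonneg hr.1]
    rw [hF _ (by simpa [hnorm] using hr.2), hnorm]
  have hd : DifferentiableAt ℝ (fun r : ℝ => F (r • e)) 1 :=
    (hdiff.comp (by fun_prop : Differentiable ℝ fun r : ℝ => r • e)) 1
  have hslope := (hasDerivAt_iff_tendsto_slope.1 hd.hasDerivAt).mono_left
    (nhdsWithin_mono (1 : ℝ) (fun _ hr => ne_of_lt hr : Iio (1 : ℝ) ⊆ {1}ᶜ))
  refine not_tendsto_nhds_of_tendsto_atBot ?_ _ hslope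
  have hbot := tendsto_neg_atTop_atBot.comp
    (tendsto_gProfile_sub_div.const_mul_atTop (zero_lt_two' ℝ))
  refine hbot.congr' ?_
  filter_upwards [Ioo_mem_nhdsLT (zero_lt_one' ℝ)] with r hr
  have h1 : 1 - r ≠ 0 := (sub_pos.2 hr.2).ne'
  have h2 : r - 1 ≠ 0 := (sub_neg.2 hr.2).ne
  rw [slope_def_field, hval r ⟨hr.1.le, hr.2.le⟩, hval 1 ⟨zero_le_one, le_rfl⟩, gProfile_one,
    Function.comp_apply, eq_div_iff h2]
  field_simp
  ring

/-- The boundary non-smoothness of `N(1)` asserted in Section 5.1 of the paper: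
`g(1) = 4`, `(g(r) - 4)/(1 - r) → +∞` as `r → 1⁻`, `g` is not Lipschitz on `[0,1]`,
and `N(1) : x ↦ 2 g(‖x‖)` has no continuously differentiable (in particular no `C^∞`)
extension to the closed unit disk. -/
theorem normal_operator_one_not_smooth :
    gProfile 1 = 4 ∧
    Tendsto (fun r => (gProfile r - 4) / (1 - r)) (𝓝[<] (1 : ℝ)) atTop ∧
    (∀ K : ℝ≥0, ¬ LipschitzOnWith K gProfile (Set.Icc (0 : ℝ) 1)) ∧
    (¬ ∃ F : EuclideanSpace ℝ (Fin 2) → ℝ, ContDiff ℝ 1 F ∧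
        ∀ x ∈ Metric.closedBall (0 : EuclideanSpace ℝ (Fin 2)) 1, F x = 2 * gProfile ‖x‖) ∧
    (¬ ∃ F : EuclideanSpace ℝ (Fin 2) → ℝ, ContDiff ℝ (⊤ : ℕ∞) F ∧
        ∀ x ∈ Metric.closedBall (0 : EuclideanSpace ℝ (Fin 2)) 1, F x = 2 * gProfile ‖x‖) := by
  exact ⟨gProfile_one, tendsto_gProfile_sub_div, not_lipschitzOnWith_gProfile,
    fun ⟨_, hC, hF⟩ => not_differentiable_of_eq_gProfile_norm hF (hC.differentiable (by simp)),
    fun ⟨_, hC, hF⟩ => not_differentiable_of_eq_gProfile_norm hF (hC.differentiable (by simp))⟩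
end
end
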